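/- There exist a natural number m and a finite set D of triples (p, q, S) with p, q ∈ Fin (m + 5) and S a finite set of integers, with the following properties, where an assignment v : Fin (m + 5) → ℤ is said to trigger (p, q, S) if v p − v q ∈ S, index 0 plays the role of the reference Z, indices 1, 2, 3 are the inputs, and index 4 is the output: (i) for every v with v 0 = 0, v 1, v 2, v 3 ∈ {0, 1}, and v j ∈ {0, 1, 2} for all j ≥ 4, if v 1 = v 2 = v 3 = 1 and v triggers no element of D, then v 4 = 1; and (ii) for all g1, g2, g3 ∈ {0, 1} not all equal to 1, there exists v with v 0 = 0, v 1 = g1, v 2 = g2, v 3 = g3, v j ∈ {0, 1, 2} for all j ≥ 4, v 4 = 0, and v triggers no element of D. -/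

import Mathlib

/-- Existence of the and-gadget used in the Σ₂ᵖ-hardness proof for SC-DTNU:
there is a gadget (with `m` internal timepoints beyond the reference, the three
inputs, and the output, and a finite set `D` of difference-disjuncts of the
global goal constraint) such that (i) when all three inputs are 1, every
assignment triggering no disjunct has output 1, and (ii) when the inputs are
not all 1, the internal timepoints can be set so that the output is 0 and no
disjunct is triggered. -/
theorem and_gadget_exists :
    ∃ (m : ℕ) (D : Finset (Fin (m + 5) × Fin (m + 5) × Finset ℤ)),
      (∀ v : Fin (m + 5) → ℤ,
          v 0 = 0 →
          v 1 ∈ ({0, 1} : Set ℤ) → v 2 ∈ ({0, 1} : Set ℤ) →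
          v 3 ∈ ({0, 1} : Set ℤ) →
          (∀ j : Fin (m + 5), 4 ≤ j.val → v j ∈ ({0, 1, 2} : Set ℤ)) →
          v 1 = 1 → v 2 = 1 → v 3 = 1 →
          (∀ t ∈ D, v t.1 - v t.2.1 ∉ t.2.2) →
          v 4 = 1) ∧
      (∀ g1 g2 g3 : ℤ, g1 ∈ ({0, 1} : Set ℤ) → g2 ∈ ({0, 1} : Set ℤ) →
          g3 ∈ ({0, 1} : Set ℤ) → ¬(g1 = 1 ∧ g2 = 1 ∧ g3 = 1) →
          ∃ v : Fin (m + 5) → ℤ,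
            v 0 = 0 ∧ v 1 = g1 ∧ v 2 = g2 ∧ v 3 = g3 ∧
            (∀ j : Fin (m + 5), 4 ≤ j.val → v j ∈ ({0, 1, 2} : Set ℤ)) ∧
            v 4 = 0 ∧
            (∀ t ∈ D, v t.1 - v t.2.1 ∉ t.2.2)) := by
  refine ⟨4, {(4, 0, {2}), (6, 5, {-1, 0, 2}), (5, 1, {-1}), (6, 2, {-1}), (6, 7, {2}),
    (8, 7, {-1, 0, 2}), (8, 3, {-1}), (8, 4, {2})}, ?_, ?_⟩
  · intro v h0 _ _ _ hv h1 h2 h3 hD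
    have h4 := hv 4 (by decide)
    have h5 := hv 5 (by decide)
    have h6 := hv 6 (by decide)
    have h7 := hv 7 (by decide)
    have h8 := hv 8 (by decide)
    simp only [forall_eq_or_imp, Finset.mem_singleton, forall_eq, Finset.mem_insert,
      Set.mem_insert_iff, Set.mem_singleton_iff] at hD h4 h5 h6 h7 h8
    omega
  · intro g1 g2 g3 hg1 hg2 hg3 hg
    simp only [Set.mem_insert_iff, Set.mem_singleton_iff] at hg1 hg2 hg3
    obtain ⟨a, b, c, d, ha, hb, hc, hd, hba, ha1, hb2, hbc, hdc, hd3, hd4⟩ :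
        ∃ a b c d : ℤ, (a = 0 ∨ a = 1 ∨ a = 2) ∧ (b = 0 ∨ b = 1 ∨ b = 2) ∧
          (c = 0 ∨ c = 1 ∨ c = 2) ∧ (d = 0 ∨ d = 1 ∨ d = 2) ∧
          ¬(b - a = -1 ∨ b - a = 0 ∨ b - a = 2) ∧ a - g1 ≠ -1 ∧ b - g2 ≠ -1 ∧ b - c ≠ 2 ∧
          ¬(d - c = -1 ∨ d - c = 0 ∨ d - c = 2) ∧ d - g3 ≠ -1 ∧ d - 0 ≠ 2 := by
      rcases hg1 with rfl | rfl
      · exact ⟨0, 1, 0, 1, by omega⟩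
      rcases hg2 with rfl | rfl
      · exact ⟨2, 0, 0, 1, by omega⟩
      exact ⟨1, 2, 2, 0, by omega⟩
    refine ⟨![0, g1, g2, g3, 0, a, b, c, d], rfl, rfl, rfl, rfl, ?_, rfl, ?_⟩
    · intro j hj
      simp only [Set.mem_insert_iff, Set.mem_singleton_iff]
      fin_cases j <;> first | exact absurd hj (by decide) | exact Or.inl rfl | assumption
    · simp only [forall_eq_or_imp, Finset.mem_singleton, forall_eq, Finset.mem_insert]
      exact ⟨show ¬((0 : ℤ) - 0 = 2) by decide, hba, ha1, hb2, hbc, hdc, hd3, hd4⟩
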